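/- Let p be a prime, let n ≥ 4, and let L be a Lie ring of cardinality p^n that is nilpotent of class exactly n−1. If a ∈ L satisfies p•a ∈ L^{n−2} and p•a ∉ L^{n−1}, then a centralizes L^{n−2}; that is, [x, a] = 0 for every x ∈ L^{n−2}. -/

import Mathlib

/-- A Lie ring is nilpotent of class exactly `c`: `L^{c+1} = 0` and `L^c ≠ 0`. -/
def LieClassEq (α : Type*) [LieRing α] (c : ℕ) : Prop :=
  LieModule.lowerCentralSeries ℤ α α c = ⊥ ∧ LieModule.lowerCentralSeries ℤ α α (c - 1) ≠ ⊥

/-- If `A ≤ B` have orders `p ^ k` and `p ^ (k + 1)`, then `B` is generated by `A` together with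
any element of `B` outside `A`. -/
theorem AddSubgroup.exists_sub_zsmul_mem_of_card {G : Type*} [AddCommGroup G] [Finite G]
    {p k : ℕ} (hp : p.Prime) {A B : AddSubgroup G} (hAB : A ≤ B)
    (hA : Nat.card A = p ^ k) (hB : Nat.card B = p ^ (k + 1))
    {x : G} (hxB : x ∈ B) (hxA : x ∉ A) {y : G} (hy : y ∈ B) :
    ∃ m : ℤ, y - m • x ∈ A := by
  set C := AddSubgroup.zmultiples x ⊔ A with hC
  have hxC : x ∈ C := (le_sup_left : _ ≤ C) (AddSubgroup.mem_zmultiples x)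
  have hAC : A ≤ C := le_sup_right
  have hCB : C ≤ B := sup_le (by simpa [AddSubgroup.zmultiples_le] using hxB) hAB
  obtain ⟨j, hj, hCj⟩ := (Nat.dvd_prime_pow hp).1 (hB ▸ AddSubgroup.card_dvd_of_le hCB)
  have hkj : k ≤ j := (Nat.pow_dvd_pow_iff_le_right hp.one_lt).1
    (hA ▸ hCj ▸ AddSubgroup.card_dvd_of_le hAC)
  have hne : k ≠ j := by
    rintro rfl
    exact hxA (AddSubgroup.eq_of_le_of_card_ge hAC (by rw [hA, hCj]) ▸ hxC)
  have hjk : j = k + 1 := by omega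
  have hCB' : C = B := AddSubgroup.eq_of_le_of_card_ge hCB (by rw [hB, hCj, hjk])
  rw [← hCB', hC, AddSubgroup.mem_sup] at hy
  obtain ⟨u, hu, v, hv, rfl⟩ := hy
  obtain ⟨m, rfl⟩ := AddSubgroup.mem_zmultiples_iff.1 hu
  exact ⟨m, by simpa using hv⟩

namespace LieRing

open LieModule

variable {L : Type*} [LieRing L]

/-- The lower central series stabilizes as soon as two consecutive terms agree. -/
theorem lowerCentralSeries_eq_of_succ_eq {i : ℕ}
    (h : lowerCentralSeries ℤ L L (i + 1) = lowerCentralSeries ℤ L L i) (k : ℕ) :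
    lowerCentralSeries ℤ L L (i + k) = lowerCentralSeries ℤ L L i := by
  induction k with
  | zero => rfl
  | succ k ih => rw [← add_assoc, lowerCentralSeries_succ, ih, ← lowerCentralSeries_succ, h]

theorem lie_mem_lowerCentralSeries_succ (x : L) {y : L} {i : ℕ}
    (hy : y ∈ lowerCentralSeries ℤ L L i) : ⁅x, y⁆ ∈ lowerCentralSeries ℤ L L (i + 1) := by
  rw [lowerCentralSeries_succ]
  exact LieSubmodule.lie_mem_lie (LieSubmodule.mem_top x) hy

/-- If `L / L²` is cyclic, then `L² = L³`. -/
theorem lowerCentralSeries_two_eq_one_of_cyclic (x : L)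
    (h : ∀ y : L, ∃ m : ℤ, y - m • x ∈ lowerCentralSeries ℤ L L 1) :
    lowerCentralSeries ℤ L L 2 = lowerCentralSeries ℤ L L 1 := by
  refine le_antisymm (antitone_lowerCentralSeries ℤ L L one_le_two) ?_
  rw [lowerCentralSeries_succ ℤ L L 0, LieSubmodule.lie_le_iff]
  intro u _ v _
  obtain ⟨m, hm⟩ := h u
  obtain ⟨k, hk⟩ := h v
  have h₁ : ⁅u, v - k • x⁆ ∈ lowerCentralSeries ℤ L L 2 := lie_mem_lowerCentralSeries_succ u hk
  have h₂ : ⁅k • x, u - m • x⁆ ∈ lowerCentralSeries ℤ L L 2 :=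
    lie_mem_lowerCentralSeries_succ _ hm
  have h₃ : ⁅u, v⁆ = ⁅u, v - k • x⁆ - ⁅k • x, u - m • x⁆ := by
    rw [lie_sub, lie_sub, ← lie_skew u (k • x)]
    simp
  rw [h₃]
  exact sub_mem h₁ h₂

end LieRing

/-- If `L` has order `p^n` (`n ≥ 4`) and maximal class `n-1`, and `a ∈ L` satisfies
`p•a ∈ L^{n-2}` and `p•a ∉ L^{n-1}`, then `a` centralizes `L^{n-2}`.
(Here `L^i` is `LieModule.lowerCentralSeries ℤ L L (i-1)`.) -/
theorem centralizes_of_smul_not_in_last (p n : ℕ) (hp : p.Prime) (hn : 4 ≤ n)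
    (L : Type*) [LieRing L] (hcard : Nat.card L = p ^ n) (hclass : LieClassEq L (n - 1))
    (a : L) (h1 : p • a ∈ LieModule.lowerCentralSeries ℤ L L (n - 3))
    (h2 : p • a ∉ LieModule.lowerCentralSeries ℤ L L (n - 2)) :
    ∀ x ∈ LieModule.lowerCentralSeries ℤ L L (n - 3), ⁅x, a⁆ = 0 := by
  obtain ⟨hbot, hne⟩ := hclass
  have : Finite L := Nat.finite_of_card_ne_zero (hcard ▸ (pow_pos hp.pos n).ne')
  let A (i : ℕ) : AddSubgroup L := (LieModule.lowerCentralSeries ℤ L L i).toSubmodule.toAddSubgroup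
  have hA : ∀ i, A (i + 1) ≤ A i := fun i =>
    LieModule.antitone_lowerCentralSeries ℤ L L i.le_succ
  have hstrict : ∀ i ≤ n - 2, LieModule.lowerCentralSeries ℤ L L (i + 1) ≠
      LieModule.lowerCentralSeries ℤ L L i := by
    intro i hi h
    have e := LieRing.lowerCentralSeries_eq_of_succ_eq h (n - 1 - i)
    rw [show i + (n - 1 - i) = n - 1 by omega, hbot] at e
    refine hne (le_bot_iff.1 (e ▸ LieModule.antitone_lowerCentralSeries ℤ L L ?_))
    omega
  have hpow : ∀ i, ∃ k, Nat.card (A i) = p ^ k := fun i => by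
    obtain ⟨k, -, hk⟩ := (Nat.dvd_prime_pow hp).1 (hcard ▸ (A i).card_addSubgroup_dvd_card)
    exact ⟨k, hk⟩
  choose k hk using hpow
  have hlt : ∀ i ≤ n - 2, k (i + 1) < k i := by
    intro i hi
    refine lt_of_le_of_ne ((Nat.pow_dvd_pow_iff_le_right hp.one_lt).1
      (hk i ▸ hk (i + 1) ▸ AddSubgroup.card_dvd_of_le (hA i))) fun e => hstrict i hi ?_
    have e' : A (i + 1) = A i :=
      AddSubgroup.eq_of_le_of_card_ge (hA i) (by rw [hk, hk, e])
    exact SetLike.coe_injective (congrArg (fun B : AddSubgroup L => (B : Set L)) e')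
  have hA0 : A 0 = ⊤ := by simp [A]
  have hk0 : k 0 = n := by
    have e := hk 0
    rw [hA0, AddSubgroup.card_top, hcard] at e
    exact (Nat.pow_right_injective hp.two_le e).symm
  have hk1 : k 1 ≤ n - 2 := by
    by_contra hcon
    have h01 := hlt 0 (by omega)
    rw [zero_add] at h01
    obtain ⟨x, hx⟩ : ∃ x, x ∉ A 1 := by
      by_contra! hall
      exact hstrict 0 (by omega) (eq_top_iff.2 fun y _ => hall y)
    refine hstrict 1 (by omega) (LieRing.lowerCentralSeries_two_eq_one_of_cyclic x fun y => ?_)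
    exact AddSubgroup.exists_sub_zsmul_mem_of_card hp (hA 0) (hk 1)
      (by rw [hk 0]; congr 1; omega) (by simp [hA0]) hx (by simp [hA0])
  have hdesc : ∀ i, i ≤ n - 2 → k (i + 1) + i ≤ n - 2 := by
    intro i
    induction i with
    | zero => intro _; simpa using hk1
    | succ i ih =>
      intro hi
      have := ih (by omega)
      have := hlt (i + 1) hi
      omega
  obtain ⟨r, rfl⟩ : ∃ r, n = r + 4 := ⟨n - 4, by omega⟩
  simp only [show r + 4 - 3 = r + 1 by omega, show r + 4 - 2 = r + 2 by omega,
    show r + 4 - 1 = r + 3 by omega] at *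
  have d₁ : k (r + 1) + r ≤ r + 2 := hdesc r (by omega)
  have d₂ : k (r + 2) < k (r + 1) := hlt (r + 1) (by omega)
  have d₃ := hlt (r + 2) (by omega)
  have hcentral : ∀ z ∈ LieModule.lowerCentralSeries ℤ L L (r + 2), ⁅a, z⁆ = 0 := fun z hz => by
    have := LieRing.lie_mem_lowerCentralSeries_succ a hz
    rwa [hbot, LieSubmodule.mem_bot] at this
  intro x hx
  obtain ⟨m, hm⟩ := AddSubgroup.exists_sub_zsmul_mem_of_card hp (hA (r + 1)) (hk (r + 2))
    (by rw [hk (r + 1)]; congr 1; omega) h1 h2 hx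
  have := hcentral _ hm
  rw [← lie_skew, neg_eq_zero]
  simpa using this
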